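/- Fix an integer n ≥ 1 and a real B ≥ 1. There exists a constant C > 0 depending only on n and B with the following property. Let φ : ℂ^n → ℝ be a smooth function which is (ℤ + ℤi)^n-periodic (φ(z + v) = φ(z) for all v ∈ (ℤ + ℤi)^n), write ∂_j = (1/2)(∂/∂x_j − i ∂/∂y_j) and ∂̄_k = (1/2)(∂/∂x_k + i ∂/∂y_k) in the coordinates z_j = x_j + i y_j, and define the Hermitian matrix g̃(z) with entries g̃(z) j k = δ_{jk} + ∂_j ∂̄_k φ(z). Assume g̃(z) is positive definite for every z, and that the function F := log det g̃ satisfies sup_z (|F(z)| + ‖DF(z)‖ + ‖D²F(z)‖) ≤ B, where DF and D²F are the first and second (real) derivatives of F. Then for every z ∈ ℂ^n, tr g̃(z) ≤ C · (1 + sup_w Re(Σ_{j,k} (g̃(w)⁻¹) j k · ∂_k φ(w) · conj(∂_j φ(w)))). -/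

import Mathlib

open ComplexOrder

/-- The Wirtinger derivative `∂_j ψ = (1/2)(∂/∂x_j − i ∂/∂y_j) ψ` of a
complex-valued function `ψ` on `ℂ^n`, computed via real directional derivatives. -/
noncomputable def wirtingerD (n : ℕ) (j : Fin n) (ψ : (Fin n → ℂ) → ℂ)
    (z : Fin n → ℂ) : ℂ :=
  (1 / 2 : ℂ) * (fderiv ℝ ψ z (Pi.single j 1)
    - Complex.I * fderiv ℝ ψ z (Pi.single j Complex.I))

/-- The conjugate Wirtinger derivative `∂̄_k ψ = (1/2)(∂/∂x_k + i ∂/∂y_k) ψ`. -/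
noncomputable def wirtingerDbar (n : ℕ) (k : Fin n) (ψ : (Fin n → ℂ) → ℂ)
    (z : Fin n → ℂ) : ℂ :=
  (1 / 2 : ℂ) * (fderiv ℝ ψ z (Pi.single k 1)
    + Complex.I * fderiv ℝ ψ z (Pi.single k Complex.I))

/-- The matrix `g̃(z)` with entries `δ_{jk} + ∂_j ∂̄_k φ(z)`. -/
noncomputable def tildeG (n : ℕ) (φ : (Fin n → ℂ) → ℝ) (z : Fin n → ℂ) :
    Matrix (Fin n) (Fin n) ℂ :=
  fun j k => (if j = k then 1 else 0)
    + wirtingerD n j (fun w => wirtingerDbar n k (fun u => (φ u : ℂ)) w) z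

namespace Matrix

variable {ι : Type*} [Fintype ι] [DecidableEq ι]

lemma PosDef.exists_unitary_diagonal {A : Matrix ι ι ℂ} (hA : A.PosDef) :
    ∃ (U : Matrix ι ι ℂ) (d : ι → ℝ), Uᴴ * U = 1 ∧ U * Uᴴ = 1 ∧ (∀ i, 0 < d i) ∧
      A = U * diagonal (fun i => (d i : ℂ)) * Uᴴ := by
  refine ⟨hA.1.eigenvectorUnitary, hA.1.eigenvalues, ?_, ?_, hA.eigenvalues_pos, ?_⟩
  · exact Unitary.coe_star_mul_self _
  · exact Unitary.coe_mul_star_self _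
  · conv_lhs => rw [hA.1.spectral_theorem]
    rfl

lemma unitary_diagonal_inv {U : Matrix ι ι ℂ} {d : ι → ℝ} (h₁ : Uᴴ * U = 1) (h₂ : U * Uᴴ = 1)
    (hd : ∀ i, 0 < d i) :
    (U * diagonal (fun i => (d i : ℂ)) * Uᴴ)⁻¹ = U * diagonal (fun i => ((d i)⁻¹ : ℂ)) * Uᴴ := by
  apply inv_eq_right_inv
  have hdd : diagonal (fun i => (d i : ℂ)) * diagonal (fun i => ((d i)⁻¹ : ℂ)) = 1 := by
    rw [diagonal_mul_diagonal, ← diagonal_one]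
    congr 1
    ext i
    exact mul_inv_cancel₀ (by exact_mod_cast (hd i).ne')
  calc _ = U * (diagonal (fun i => (d i : ℂ)) * (Uᴴ * U) *
        diagonal (fun i => ((d i)⁻¹ : ℂ))) * Uᴴ := by simp only [Matrix.mul_assoc]
    _ = 1 := by rw [h₁, Matrix.mul_one, hdd, Matrix.mul_one, h₂]

lemma trace_unitary_diagonal {U : Matrix ι ι ℂ} (c : ι → ℂ) (h₁ : Uᴴ * U = 1) :
    (U * diagonal c * Uᴴ).trace = ∑ i, c i := by
  rw [trace_mul_cycle, h₁, Matrix.one_mul, trace_diagonal]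

lemma det_unitary_diagonal {U : Matrix ι ι ℂ} (c : ι → ℂ) (h₁ : Uᴴ * U = 1) :
    (U * diagonal c * Uᴴ).det = ∏ i, c i := by
  rw [det_mul_comm, ← Matrix.mul_assoc, h₁, Matrix.one_mul, det_diagonal]

/-- The trace of a positive definite matrix is controlled by its determinant and the trace of
its inverse. -/
lemma PosDef.re_trace_le_of_re_trace_inv_le {A : Matrix ι ι ℂ} (hA : A.PosDef) {R : ℝ}
    (hR : (A⁻¹).trace.re ≤ R) :
    A.trace.re ≤ Fintype.card ι * (A.det.re * R ^ (Fintype.card ι - 1)) := by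
  obtain ⟨U, d, h₁, h₂, hd, rfl⟩ := hA.exists_unitary_diagonal
  rw [unitary_diagonal_inv h₁ h₂ hd, trace_unitary_diagonal _ h₁] at hR
  rw [trace_unitary_diagonal _ h₁, det_unitary_diagonal _ h₁]
  have hR' : ∑ i, (d i)⁻¹ ≤ R := by
    refine le_trans (le_of_eq ?_) hR
    rw [Complex.re_sum]
    exact Finset.sum_congr rfl fun i _ => by rw [← Complex.ofReal_inv, Complex.ofReal_re]
  rw [← Complex.ofReal_prod, Complex.ofReal_re, ← Complex.ofReal_sum, Complex.ofReal_re,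
    ← nsmul_eq_mul]
  refine Finset.sum_le_card_nsmul _ _ _ fun i _ => ?_
  have hle : ∀ j, (d j)⁻¹ ≤ R := fun j =>
    (Finset.single_le_sum (f := fun j => (d j)⁻¹) (fun j _ => (inv_pos.2 (hd j)).le)
      (Finset.mem_univ j)).trans hR'
  have hprod : ∏ j ∈ Finset.univ.erase i, (d j)⁻¹ ≤ R ^ (Fintype.card ι - 1) := by
    refine (Finset.prod_le_prod (fun j _ => (inv_pos.2 (hd j)).le)
      (fun j _ => hle j)).trans (le_of_eq ?_)
    rw [Finset.prod_const, Finset.card_erase_of_mem (Finset.mem_univ i), Finset.card_univ]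
  have hP : 0 < ∏ j, d j := Finset.prod_pos fun j _ => hd j
  refine le_trans (le_of_eq ?_) (mul_le_mul_of_nonneg_left hprod hP.le)
  rw [← Finset.mul_prod_erase _ _ (Finset.mem_univ i), mul_assoc, ← Finset.prod_mul_distrib,
    Finset.prod_congr rfl fun j _ => mul_inv_cancel₀ (hd j).ne', Finset.prod_const_one, mul_one]

lemma PosDef.log_re_det_le {Y : Matrix ι ι ℂ} (hY : Y.PosDef) :
    Real.log Y.det.re ≤ Y.trace.re - Fintype.card ι := by
  obtain ⟨U, d, h₁, h₂, hd, rfl⟩ := hY.exists_unitary_diagonal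
  rw [trace_unitary_diagonal _ h₁, det_unitary_diagonal _ h₁, ← Complex.ofReal_prod,
    Complex.ofReal_re, ← Complex.ofReal_sum, Complex.ofReal_re,
    Real.log_prod fun i _ => (hd i).ne']
  have := Finset.sum_le_sum fun i (_ : i ∈ Finset.univ) => Real.log_le_sub_one_of_pos (hd i)
  simpa [Finset.sum_sub_distrib] using this

lemma PosDef.re_det_pos {A : Matrix ι ι ℂ} (hA : A.PosDef) : 0 < A.det.re :=
  (Complex.pos_iff.1 hA.det_pos).1

lemma PosDef.ofReal_re_det {A : Matrix ι ι ℂ} (hA : A.PosDef) : (A.det.re : ℂ) = A.det :=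
  Complex.ext rfl (Complex.pos_iff.1 hA.det_pos).2

lemma PosDef.exists_eq_mul_conjTranspose {A : Matrix ι ι ℂ} (hA : A.PosDef) :
    ∃ S : Matrix ι ι ℂ, A = S * Sᴴ := by
  obtain ⟨U, d, h₁, h₂, hd, rfl⟩ := hA.exists_unitary_diagonal
  refine ⟨U * diagonal fun i => (Real.sqrt (d i) : ℂ), ?_⟩
  rw [conjTranspose_mul, Matrix.mul_assoc U (diagonal fun i => (Real.sqrt (d i) : ℂ)),
    ← Matrix.mul_assoc _ _ Uᴴ, diagonal_conjTranspose, diagonal_mul_diagonal, Matrix.mul_assoc]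
  congr 3
  ext i
  rw [Pi.star_apply, Complex.star_def, Complex.conj_ofReal, ← Complex.ofReal_mul,
    Real.mul_self_sqrt (hd i).le]

/-- Concavity of `log det` on positive definite matrices, in tangent form. -/
lemma PosDef.log_re_det_le_add {A X : Matrix ι ι ℂ} (hA : A.PosDef) (hX : X.PosDef) :
    Real.log X.det.re ≤ Real.log A.det.re + (A⁻¹ * X).trace.re - Fintype.card ι := by
  obtain ⟨S, hS⟩ := hA.inv.exists_eq_mul_conjTranspose
  have hdet : A⁻¹.det = S.det * Sᴴ.det := by rw [hS, det_mul]
  have hSu : IsUnit S.det := by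
    rw [isUnit_iff_ne_zero]
    intro h
    rw [h, zero_mul] at hdet
    exact hA.inv.det_pos.ne' hdet
  have hY : (Sᴴ * X * S).PosDef :=
    hX.conjTranspose_mul_mul_same (mulVec_injective_of_isUnit ((isUnit_iff_isUnit_det S).2 hSu))
  have := hY.log_re_det_le
  have htr : (Sᴴ * X * S).trace = (A⁻¹ * X).trace := by rw [trace_mul_cycle, hS]
  have hd : (Sᴴ * X * S).det.re = (A.det.re)⁻¹ * X.det.re := by
    have : (Sᴴ * X * S).det = (A.det.re : ℂ)⁻¹ * (X.det.re : ℂ) := by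
      rw [hA.ofReal_re_det, hX.ofReal_re_det, det_mul, det_mul, mul_right_comm,
        mul_comm Sᴴ.det, ← hdet, det_nonsing_inv, Ring.inverse_eq_inv']
    rw [this, ← Complex.ofReal_inv, ← Complex.ofReal_mul, Complex.ofReal_re]
  rw [htr, hd, Real.log_mul (inv_pos.2 hA.re_det_pos).ne' hX.re_det_pos.ne', Real.log_inv] at this
  linarith

lemma sum_mul_mul_conj_eq_dotProduct {m : Type*} [Fintype m] (G : Matrix m m ℂ) (a : m → ℂ) :
    ∑ j, ∑ k, G j k * a k * (starRingEnd ℂ) (a j) = star a ⬝ᵥ (G *ᵥ a) := by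
  simp only [dotProduct, mulVec, Finset.mul_sum, Pi.star_apply]
  exact Finset.sum_congr rfl fun j _ => Finset.sum_congr rfl fun k _ => mul_comm _ _

lemma PosDef.sum_normSq_le {A : Matrix ι ι ℂ} (hA : A.PosDef) (a : ι → ℂ) :
    ∑ i, Complex.normSq (a i) ≤
      A.trace.re * (∑ j, ∑ k, A⁻¹ j k * a k * (starRingEnd ℂ) (a j)).re := by
  obtain ⟨S, rfl⟩ := hA.exists_eq_mul_conjTranspose
  have hSu : IsUnit S.det := by
    rw [isUnit_iff_ne_zero]
    intro h
    apply hA.det_pos.ne'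
    rw [det_mul, h, zero_mul]
  set c := S⁻¹ *ᵥ a with hc
  have ha : a = S *ᵥ c := by rw [hc, mulVec_mulVec, mul_nonsing_inv _ hSu, one_mulVec]
  have hQ : (∑ j, ∑ k, (S * Sᴴ)⁻¹ j k * a k * (starRingEnd ℂ) (a j)).re = ∑ l, ‖c l‖ ^ 2 := by
    have h : star a ⬝ᵥ ((S * Sᴴ)⁻¹ *ᵥ a) = star c ⬝ᵥ c := by
      rw [hc, star_mulVec, ← dotProduct_mulVec, mulVec_mulVec, conjTranspose_nonsing_inv,
        mul_inv_rev]
    rw [sum_mul_mul_conj_eq_dotProduct, h, dotProduct, Complex.re_sum]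
    refine Finset.sum_congr rfl fun l _ => ?_
    rw [Pi.star_apply, Complex.star_def, Complex.conj_mul', ← Complex.ofReal_pow,
      Complex.ofReal_re]
  have htr : (S * Sᴴ).trace.re = ∑ i, ∑ l, ‖S i l‖ ^ 2 := by
    rw [trace, Complex.re_sum]
    refine Finset.sum_congr rfl fun i _ => ?_
    rw [diag_apply, mul_apply, Complex.re_sum]
    refine Finset.sum_congr rfl fun l _ => ?_
    rw [conjTranspose_apply, Complex.star_def, Complex.mul_conj', ← Complex.ofReal_pow,
      Complex.ofReal_re]
  rw [hQ, htr, Finset.sum_mul]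
  refine Finset.sum_le_sum fun i _ => ?_
  have h1 : ‖a i‖ ≤ ∑ l, ‖S i l‖ * ‖c l‖ := by
    rw [ha, mulVec, dotProduct]
    exact (norm_sum_le _ _).trans (le_of_eq (Finset.sum_congr rfl fun l _ => norm_mul _ _))
  calc Complex.normSq (a i) = ‖a i‖ ^ 2 := Complex.normSq_eq_norm_sq _
    _ ≤ (∑ l, ‖S i l‖ * ‖c l‖) ^ 2 := pow_le_pow_left₀ (norm_nonneg _) h1 2
    _ ≤ _ := Finset.sum_mul_sq_le_sq_mul_sq _ _ _

end Matrix

section DirectionalDerivative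

variable {E : Type*} [NormedAddCommGroup E] [NormedSpace ℝ E] {κ κ' : Type*} [Fintype κ]
  [Fintype κ']

/-- The derivative of `f` in the constant direction `u`. -/
noncomputable def dirDeriv (u : E) (f : E → ℝ) : E → ℝ := fun z => fderiv ℝ f z u

/-- The second order operator `∑ i, D_{u i} D_{u i}`. -/
noncomputable def sumSqDeriv (u : κ → E) (f : E → ℝ) : E → ℝ :=
  fun z => ∑ i, dirDeriv (u i) (dirDeriv (u i) f) z

lemma ContDiff.dirDeriv {f : E → ℝ} (hf : ContDiff ℝ (⊤ : ℕ∞) f) (u : E) :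
    ContDiff ℝ (⊤ : ℕ∞) (dirDeriv u f) :=
  (contDiff_infty_iff_fderiv.1 hf).2.clm_apply contDiff_const

lemma ContDiff.differentiable_infty {f : E → ℝ} (hf : ContDiff ℝ (⊤ : ℕ∞) f) :
    Differentiable ℝ f :=
  (contDiff_infty_iff_fderiv.1 hf).1

lemma ContDiff.sumSqDeriv {f : E → ℝ} (hf : ContDiff ℝ (⊤ : ℕ∞) f) (u : κ → E) :
    ContDiff ℝ (⊤ : ℕ∞) (sumSqDeriv u f) :=
  ContDiff.sum fun i _ => (hf.dirDeriv (u i)).dirDeriv (u i)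

lemma dirDeriv_dirDeriv {f : E → ℝ} (hf : ContDiff ℝ (⊤ : ℕ∞) f) (u v z : E) :
    dirDeriv u (dirDeriv v f) z = fderiv ℝ (fderiv ℝ f) z u v := by
  have h := (contDiff_infty_iff_fderiv.1 (contDiff_infty_iff_fderiv.1 hf).2).1 z
  unfold dirDeriv
  rw [fderiv_clm_apply h (differentiableAt_const v)]
  simp

lemma dirDeriv_comm {f : E → ℝ} (hf : ContDiff ℝ (⊤ : ℕ∞) f) (u v : E) :
    dirDeriv u (dirDeriv v f) = dirDeriv v (dirDeriv u f) := by
  ext z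
  rw [dirDeriv_dirDeriv hf, dirDeriv_dirDeriv hf]
  exact (hf.contDiffAt.isSymmSndFDerivAt (by
    rw [minSmoothness_of_isRCLikeNormedField]; exact WithTop.coe_le_coe.2 le_top)) u v

lemma dirDeriv_sum {f : κ → E → ℝ} (hf : ∀ i, ContDiff ℝ (⊤ : ℕ∞) (f i)) (u : E) :
    dirDeriv u (fun z => ∑ i, f i z) = fun z => ∑ i, dirDeriv u (f i) z := by
  ext z
  unfold dirDeriv
  rw [fderiv_fun_sum fun i _ => (hf i).differentiable_infty z]
  simp

lemma dirDeriv_const_add_mul_add_mul {f g : E → ℝ} (hf : ContDiff ℝ (⊤ : ℕ∞) f)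
    (hg : ContDiff ℝ (⊤ : ℕ∞) g) (c a b : ℝ) (u : E) :
    dirDeriv u (fun z => c + (a * f z + b * g z)) =
      fun z => 0 + (a * dirDeriv u f z + b * dirDeriv u g z) := by
  ext z
  have h := (((hf.differentiable_infty z).hasFDerivAt.const_mul a).fun_add
    ((hg.differentiable_infty z).hasFDerivAt.const_mul b)).const_add c
  unfold dirDeriv
  rw [h.fderiv]
  simp

lemma sumSqDeriv_const_add_mul_add_mul {f g : E → ℝ} (hf : ContDiff ℝ (⊤ : ℕ∞) f)
    (hg : ContDiff ℝ (⊤ : ℕ∞) g) (c a b : ℝ) (u : κ → E) (z : E) :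
    sumSqDeriv u (fun z => c + (a * f z + b * g z)) z =
      a * sumSqDeriv u f z + b * sumSqDeriv u g z := by
  unfold sumSqDeriv
  rw [Finset.mul_sum, Finset.mul_sum, ← Finset.sum_add_distrib]
  refine Finset.sum_congr rfl fun i _ => ?_
  rw [dirDeriv_const_add_mul_add_mul hf hg,
    dirDeriv_const_add_mul_add_mul (hf.dirDeriv _) (hg.dirDeriv _)]
  simp

lemma dirDeriv_sumSqDeriv {f : E → ℝ} (hf : ContDiff ℝ (⊤ : ℕ∞) f) (u : κ → E) (v : E) :
    dirDeriv v (sumSqDeriv u f) = sumSqDeriv u (dirDeriv v f) := by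
  unfold sumSqDeriv
  rw [dirDeriv_sum fun i => (hf.dirDeriv (u i)).dirDeriv (u i)]
  ext z
  refine Finset.sum_congr rfl fun i _ => ?_
  rw [dirDeriv_comm (hf.dirDeriv _), dirDeriv_comm hf]

lemma sumSqDeriv_comm {f : E → ℝ} (hf : ContDiff ℝ (⊤ : ℕ∞) f) (u : κ → E) (v : κ' → E) (z : E) :
    sumSqDeriv u (sumSqDeriv v f) z = sumSqDeriv v (sumSqDeriv u f) z := by
  have hl : sumSqDeriv u (sumSqDeriv v f) z = ∑ i, ∑ j,
      dirDeriv (v j) (dirDeriv (v j) (dirDeriv (u i) (dirDeriv (u i) f))) z :=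
    Finset.sum_congr rfl fun i _ => by
      rw [dirDeriv_sumSqDeriv hf, dirDeriv_sumSqDeriv (hf.dirDeriv _), sumSqDeriv]
  have hr : sumSqDeriv v (sumSqDeriv u f) z = ∑ j, ∑ i,
      dirDeriv (v j) (dirDeriv (v j) (dirDeriv (u i) (dirDeriv (u i) f))) z :=
    Finset.sum_congr rfl fun j _ => by
      unfold sumSqDeriv
      rw [dirDeriv_sum fun i => (hf.dirDeriv (u i)).dirDeriv (u i), dirDeriv_sum fun i =>
        ((hf.dirDeriv (u i)).dirDeriv (u i)).dirDeriv (v j)]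
  rw [hl, hr, Finset.sum_comm]

/-- Necessary second order condition at a local maximum, in dimension one. -/
lemma IsLocalMax.deriv_deriv_nonpos {g : ℝ → ℝ} {x : ℝ} (hg : Continuous g)
    (h : IsLocalMax g x) : deriv (deriv g) x ≤ 0 := by
  by_contra! hpos
  have hmin := isLocalMin_of_deriv_deriv_pos hpos h.deriv_eq_zero hg.continuousAt
  have hconst : g =ᶠ[nhds x] fun _ => g x := by
    filter_upwards [h, hmin] with t h₁ h₂ using le_antisymm h₁ h₂
  rw [hconst.deriv.deriv_eq] at hpos
  simp at hpos

lemma dirDeriv_dirDeriv_nonpos {f : E → ℝ} (hf : ContDiff ℝ (⊤ : ℕ∞) f) {p : E}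
    (hp : ∀ z, f z ≤ f p) (u : E) : dirDeriv u (dirDeriv u f) p ≤ 0 := by
  have key : ∀ {h : E → ℝ}, ContDiff ℝ (⊤ : ℕ∞) h →
      deriv (fun t : ℝ => h (p + t • u)) = fun t : ℝ => dirDeriv u h (p + t • u) := by
    intro h hh
    ext t
    have h1 : HasDerivAt (fun t : ℝ => p + t • u) u t := by
      simpa using ((hasDerivAt_id t).smul_const u).const_add p
    exact ((hh.differentiable_infty _).hasFDerivAt.comp_hasDerivAt t h1).deriv
  have hg : Continuous fun t : ℝ => f (p + t • u) := hf.continuous.comp (by fun_prop)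
  have hmax : IsLocalMax (fun t : ℝ => f (p + t • u)) 0 :=
    Filter.Eventually.of_forall fun t => by simpa using hp (p + t • u)
  have := hmax.deriv_deriv_nonpos hg
  rw [key hf, key (hf.dirDeriv u)] at this
  simpa using this

lemma sumSqDeriv_nonpos {f : E → ℝ} (hf : ContDiff ℝ (⊤ : ℕ∞) f) {p : E}
    (hp : ∀ z, f z ≤ f p) (u : κ → E) : sumSqDeriv u f p ≤ 0 :=
  Finset.sum_nonpos fun i _ => dirDeriv_dirDeriv_nonpos hf hp (u i)

lemma abs_dirDeriv_dirDeriv_le {f : E → ℝ} (hf : ContDiff ℝ (⊤ : ℕ∞) f) {u : E} (hu : ‖u‖ ≤ 1)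
    (z : E) : |dirDeriv u (dirDeriv u f) z| ≤ ‖iteratedFDeriv ℝ 2 f z‖ := by
  rw [dirDeriv_dirDeriv hf]
  have h := (iteratedFDeriv ℝ 2 f z).le_opNorm fun _ => u
  rw [iteratedFDeriv_two_apply] at h
  refine h.trans (mul_le_of_le_one_right (norm_nonneg _) ?_)
  exact Finset.prod_le_one (fun _ _ => norm_nonneg _) fun _ _ => hu

lemma neg_card_mul_le_sumSqDeriv {f : E → ℝ} (hf : ContDiff ℝ (⊤ : ℕ∞) f) {u : κ → E}
    (hu : ∀ i, ‖u i‖ ≤ 1) {z : E} {B : ℝ} (hB : ‖iteratedFDeriv ℝ 2 f z‖ ≤ B) :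
    -(Fintype.card κ * B) ≤ sumSqDeriv u f z := by
  have h := Finset.card_nsmul_le_sum Finset.univ
    (fun i => dirDeriv (u i) (dirDeriv (u i) f) z) (-B) fun i _ =>
      (abs_le.1 ((abs_dirDeriv_dirDeriv_le hf (hu i) z).trans hB)).1
  rw [Finset.card_univ, nsmul_eq_mul, mul_neg] at h
  exact h

end DirectionalDerivative

section ComplexHessian

variable {n : ℕ} {φ : (Fin n → ℂ) → ℝ}

/-- The vectors `v i` together with their rotations `I • v i`. -/
noncomputable def withRotation {ι : Type*} (v : ι → Fin n → ℂ) : ι ⊕ ι → Fin n → ℂ :=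
  Sum.elim v fun i => Complex.I • v i

lemma sum_single_re_add_im (v : Fin n → ℂ) :
    v = ∑ k, ((v k).re • (Pi.single k 1 : Fin n → ℂ)
      + (v k).im • (Pi.single k Complex.I : Fin n → ℂ)) := by
  ext i
  simp only [Finset.sum_apply, Pi.add_apply, Pi.smul_apply, Pi.single_apply]
  rw [Finset.sum_eq_single i (fun k _ hk => by simp [hk.symm]) (by simp)]
  simp [Complex.re_add_im]

lemma wirtingerD_ofReal_comp (hφ : Differentiable ℝ φ) (k : Fin n) (z : Fin n → ℂ) :
    wirtingerD n k (fun u => (φ u : ℂ)) z =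
      (1 / 2 : ℂ) * ((dirDeriv (Pi.single k 1) φ z : ℂ)
        - Complex.I * (dirDeriv (Pi.single k Complex.I) φ z : ℂ)) := by
  have h : HasFDerivAt (fun u => (φ u : ℂ)) (Complex.ofRealCLM.comp (fderiv ℝ φ z)) z :=
    Complex.ofRealCLM.hasFDerivAt.comp z (hφ z).hasFDerivAt
  unfold wirtingerD
  rw [h.fderiv]
  rfl

lemma wirtingerDbar_ofReal_comp (hφ : Differentiable ℝ φ) (k : Fin n) (z : Fin n → ℂ) :
    wirtingerDbar n k (fun u => (φ u : ℂ)) z =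
      (1 / 2 : ℂ) * ((dirDeriv (Pi.single k 1) φ z : ℂ)
        + Complex.I * (dirDeriv (Pi.single k Complex.I) φ z : ℂ)) := by
  have h : HasFDerivAt (fun u => (φ u : ℂ)) (Complex.ofRealCLM.comp (fderiv ℝ φ z)) z :=
    Complex.ofRealCLM.hasFDerivAt.comp z (hφ z).hasFDerivAt
  unfold wirtingerDbar
  rw [h.fderiv]
  rfl

lemma tildeG_apply (hφ : ContDiff ℝ (⊤ : ℕ∞) φ) (z : Fin n → ℂ) (j k : Fin n) :
    tildeG n φ z j k = (1 : Matrix (Fin n) (Fin n) ℂ) j k + (1 / 4 : ℂ) *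
      (((dirDeriv (Pi.single j 1) (dirDeriv (Pi.single k 1) φ) z
          + dirDeriv (Pi.single j Complex.I) (dirDeriv (Pi.single k Complex.I) φ) z : ℝ) : ℂ)
        + Complex.I * ((dirDeriv (Pi.single j 1) (dirDeriv (Pi.single k Complex.I) φ) z
          - dirDeriv (Pi.single j Complex.I) (dirDeriv (Pi.single k 1) φ) z : ℝ) : ℂ)) := by
  have hD : ∀ u, HasFDerivAt (fun w => (dirDeriv u φ w : ℂ))
      (Complex.ofRealCLM.comp (fderiv ℝ (dirDeriv u φ) z)) z := fun u =>
    Complex.ofRealCLM.hasFDerivAt.comp z ((hφ.dirDeriv u).differentiable_infty z).hasFDerivAt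
  have h := ((hD (Pi.single k 1)).add
    ((hD (Pi.single k Complex.I)).const_mul Complex.I)).const_mul (1 / 2 : ℂ)
  have hbar : (fun w => wirtingerDbar n k (fun u => (φ u : ℂ)) w) = _ :=
    funext fun w => wirtingerDbar_ofReal_comp hφ.differentiable_infty k w
  unfold tildeG
  rw [hbar, wirtingerD, Matrix.one_apply]
  erw [h.fderiv]
  have e : ∀ u v, fderiv ℝ (dirDeriv u φ) z v = dirDeriv v (dirDeriv u φ) z := fun _ _ => rfl
  simp only [smul_apply, add_apply,
    ContinuousLinearMap.comp_apply, Complex.ofRealCLM_apply, smul_eq_mul, e]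
  push_cast
  linear_combination (-1 / 4 * (dirDeriv (Pi.single j Complex.I)
    (dirDeriv (Pi.single k Complex.I) φ) z : ℂ)) * Complex.I_sq

lemma contDiff_tildeG_apply (hφ : ContDiff ℝ (⊤ : ℕ∞) φ) (j k : Fin n) :
    ContDiff ℝ (⊤ : ℕ∞) fun z => tildeG n φ z j k := by
  simp_rw [tildeG_apply hφ]
  have h : ∀ u v : Fin n → ℂ, ContDiff ℝ (⊤ : ℕ∞) (dirDeriv u (dirDeriv v φ)) :=
    fun u v => (hφ.dirDeriv v).dirDeriv u
  have hc : ∀ {f : (Fin n → ℂ) → ℝ}, ContDiff ℝ (⊤ : ℕ∞) f →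
      ContDiff ℝ (⊤ : ℕ∞) fun z => (f z : ℂ) := fun hf => Complex.ofRealCLM.contDiff.comp hf
  exact contDiff_const.add (contDiff_const.mul ((hc ((h _ _).add (h _ _))).add
    (contDiff_const.mul (hc ((h _ _).sub (h _ _))))))

lemma contDiff_re_det_tildeG (hφ : ContDiff ℝ (⊤ : ℕ∞) φ) :
    ContDiff ℝ (⊤ : ℕ∞) fun z => (tildeG n φ z).det.re := by
  refine Complex.reCLM.contDiff.comp (f := fun z => (tildeG n φ z).det) ?_
  simp_rw [Matrix.det_apply]
  exact ContDiff.sum fun σ _ => (contDiff_prod fun i _ => contDiff_tildeG_apply hφ _ _).const_smul _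

lemma re_trace_tildeG (hφ : ContDiff ℝ (⊤ : ℕ∞) φ) (z : Fin n → ℂ) :
    (tildeG n φ z).trace.re =
      n + 1 / 4 * sumSqDeriv (withRotation fun k => Pi.single k (1 : ℂ)) φ z := by
  have hI : ∀ k : Fin n, Complex.I • (Pi.single k 1 : Fin n → ℂ) = Pi.single k Complex.I :=
    fun k => by rw [← Pi.single_smul', smul_eq_mul, mul_one]
  rw [Matrix.trace, Complex.re_sum, sumSqDeriv, Fintype.sum_sum_type, ← Finset.sum_add_distrib,
    Finset.mul_sum]
  have : (n : ℝ) = ∑ _i : Fin n, (1 : ℝ) := by simp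
  rw [this, ← Finset.sum_add_distrib]
  refine Finset.sum_congr rfl fun k _ => ?_
  rw [Matrix.diag_apply, tildeG_apply hφ, Matrix.one_apply_eq]
  simp only [withRotation, Sum.elim_inl, Sum.elim_inr, hI]
  rw [dirDeriv_comm hφ (Pi.single k Complex.I) (Pi.single k 1), sub_self]
  rw [show (1 / 4 : ℂ) = ((1 / 4 : ℝ) : ℂ) by push_cast; rfl]
  simp [-one_div]

/-- The complex Hessian as a quadratic form is the average of the real second derivatives in the
directions `v` and `I • v`. -/
lemma re_sum_tildeG_sub_one (hφ : ContDiff ℝ (⊤ : ℕ∞) φ) (z v : Fin n → ℂ) :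
    (∑ j, ∑ k, v j * (starRingEnd ℂ) (v k) * (tildeG n φ z j k - (1 : Matrix _ _ ℂ) j k)).re =
      1 / 4 * (dirDeriv v (dirDeriv v φ) z
        + dirDeriv (Complex.I • v) (dirDeriv (Complex.I • v) φ) z) := by
  have hv : ∀ v : Fin n → ℂ, dirDeriv v (dirDeriv v φ) z = ∑ j, ∑ k,
      ((v j).re * (v k).re * dirDeriv (Pi.single j 1) (dirDeriv (Pi.single k 1) φ) z
      + (v j).re * (v k).im * dirDeriv (Pi.single j 1) (dirDeriv (Pi.single k Complex.I) φ) z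
      + (v j).im * (v k).re * dirDeriv (Pi.single j Complex.I) (dirDeriv (Pi.single k 1) φ) z
      + (v j).im * (v k).im *
        dirDeriv (Pi.single j Complex.I) (dirDeriv (Pi.single k Complex.I) φ) z) := by
    intro v
    simp_rw [dirDeriv_dirDeriv hφ]
    conv_lhs => rw [sum_single_re_add_im v]
    simp only [map_sum, map_add, map_smul, sum_apply,
      add_apply, smul_apply, smul_eq_mul, Finset.mul_sum,
      ← Finset.sum_add_distrib]
    rw [Finset.sum_comm]
    refine Finset.sum_congr rfl fun j _ => Finset.sum_congr rfl fun k _ => ?_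
    ring
  rw [hv v, hv (Complex.I • v), ← Finset.sum_add_distrib, Finset.mul_sum, Complex.re_sum]
  refine Finset.sum_congr rfl fun j _ => ?_
  rw [← Finset.sum_add_distrib, Finset.mul_sum, Complex.re_sum]
  refine Finset.sum_congr rfl fun k _ => ?_
  rw [tildeG_apply hφ, add_sub_cancel_left, show (1 / 4 : ℂ) = ((1 / 4 : ℝ) : ℂ) by push_cast; rfl]
  simp [-one_div]
  ring

lemma re_trace_mul_conjTranspose_mul_tildeG (hφ : ContDiff ℝ (⊤ : ℕ∞) φ) (z : Fin n → ℂ)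
    (S : Matrix (Fin n) (Fin n) ℂ) :
    (S * S.conjTranspose * tildeG n φ z).trace.re = (S * S.conjTranspose).trace.re +
      1 / 4 * sumSqDeriv (withRotation fun l j => (starRingEnd ℂ) (S j l)) φ z := by
  have h : S * S.conjTranspose * tildeG n φ z =
      S * S.conjTranspose + S * S.conjTranspose * (tildeG n φ z - 1) := by
    rw [Matrix.mul_sub, Matrix.mul_one, add_sub_cancel]
  rw [h, Matrix.trace_add, Complex.add_re, sumSqDeriv, Fintype.sum_sum_type,
    ← Finset.sum_add_distrib, Finset.mul_sum]
  simp only [withRotation, Sum.elim_inl, Sum.elim_inr, ← re_sum_tildeG_sub_one hφ]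
  rw [← Complex.re_sum]
  congr 2
  simp only [Matrix.trace, Matrix.diag_apply, Matrix.mul_apply, Finset.sum_mul,
    Matrix.conjTranspose_apply, Complex.star_def, Matrix.sub_apply, Complex.conj_conj]
  calc _ = ∑ k, ∑ l, ∑ j, _ := Finset.sum_congr rfl fun k _ => Finset.sum_comm
    _ = ∑ l, ∑ k, ∑ j, _ := Finset.sum_comm
    _ = ∑ l, ∑ j, ∑ k, _ := Finset.sum_congr rfl fun l _ => Finset.sum_comm
    _ = _ := Finset.sum_congr rfl fun l _ => Finset.sum_congr rfl fun j _ =>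
      Finset.sum_congr rfl fun k _ => by ring

lemma abs_fderiv_apply_le (hφ : Differentiable ℝ φ) (z v : Fin n → ℂ) :
    |fderiv ℝ φ z v| ≤ 2 * (∑ k, ‖wirtingerD n k (fun u => (φ u : ℂ)) z‖) * ‖v‖ := by
  have h : fderiv ℝ φ z v = ∑ k, 2 * (v k * wirtingerD n k (fun u => (φ u : ℂ)) z).re := by
    conv_lhs => rw [sum_single_re_add_im v]
    rw [map_sum]
    refine Finset.sum_congr rfl fun k _ => ?_
    rw [wirtingerD_ofReal_comp hφ, show (1 / 2 : ℂ) = ((1 / 2 : ℝ) : ℂ) by push_cast; rfl,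
      mul_left_comm, Complex.re_ofReal_mul]
    simp [dirDeriv]
  rw [h, Finset.mul_sum, Finset.sum_mul]
  refine (Finset.abs_sum_le_sum_abs _ _).trans (Finset.sum_le_sum fun k _ => ?_)
  rw [abs_mul, abs_two, mul_assoc]
  refine mul_le_mul_of_nonneg_left ((Complex.abs_re_le_norm _).trans ?_) zero_le_two
  rw [norm_mul, mul_comm]
  exact mul_le_mul_of_nonneg_left (norm_le_pi_norm v k) (norm_nonneg _)

end ComplexHessian

section LatticePeriodic

variable {n : ℕ} {α : Type*}

/-- The Gaussian lattice vector with the given integer coordinates. -/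
noncomputable def gaussianVector (v : Fin n → ℤ × ℤ) : Fin n → ℂ :=
  fun j => ((v j).1 : ℂ) + ((v j).2 : ℂ) * Complex.I

/-- Invariance under translations by the Gaussian lattice. -/
def LatticePeriodic (f : (Fin n → ℂ) → α) : Prop :=
  ∀ (z : Fin n → ℂ) (v : Fin n → ℤ × ℤ), f (z + gaussianVector v) = f z

lemma exists_norm_sub_gaussianVector_le (z : Fin n → ℂ) :
    ∃ v : Fin n → ℤ × ℤ, ‖z - gaussianVector v‖ ≤ 2 := by
  refine ⟨fun j => (⌊(z j).re⌋, ⌊(z j).im⌋), (pi_norm_le_iff_of_nonneg zero_le_two).2 fun j => ?_⟩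
  have h := Complex.norm_le_abs_re_add_abs_im ((z - gaussianVector fun j =>
    (⌊(z j).re⌋, ⌊(z j).im⌋)) j)
  have hre : ((z - gaussianVector fun j => (⌊(z j).re⌋, ⌊(z j).im⌋)) j).re = Int.fract (z j).re := by
    simp [gaussianVector]
  have him : ((z - gaussianVector fun j => (⌊(z j).re⌋, ⌊(z j).im⌋)) j).im = Int.fract (z j).im := by
    simp [gaussianVector]
  rw [hre, him, abs_of_nonneg (Int.fract_nonneg _), abs_of_nonneg (Int.fract_nonneg _)] at h
  linarith [Int.fract_lt_one (z j).re, Int.fract_lt_one (z j).im]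

lemma LatticePeriodic.exists_norm_sub_le {f : (Fin n → ℂ) → α} (hf : LatticePeriodic f)
    (z p : Fin n → ℂ) : ∃ w, ‖w - p‖ ≤ 2 ∧ f w = f z := by
  obtain ⟨v, hv⟩ := exists_norm_sub_gaussianVector_le (z - p)
  refine ⟨z - gaussianVector v, by rwa [sub_right_comm], ?_⟩
  rw [← hf (z - gaussianVector v) v, sub_add_cancel]

lemma LatticePeriodic.exists_forall_le {f : (Fin n → ℂ) → ℝ} (hf : LatticePeriodic f)
    (hc : Continuous f) : ∃ p, ∀ z, f z ≤ f p := by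
  obtain ⟨p, -, hp⟩ := (isCompact_closedBall (0 : Fin n → ℂ) 2).exists_isMaxOn
    ⟨0, Metric.mem_closedBall_self zero_le_two⟩ hc.continuousOn
  refine ⟨p, fun z => ?_⟩
  obtain ⟨w, hw, hwz⟩ := hf.exists_norm_sub_le z 0
  rw [← hwz]
  exact hp (by simpa using hw)

lemma LatticePeriodic.fderiv {F : Type*} [NormedAddCommGroup F] [NormedSpace ℝ F]
    {f : (Fin n → ℂ) → F} (hf : LatticePeriodic f) : LatticePeriodic (fderiv ℝ f) := by
  intro z v
  rw [← fderiv_comp_add_right]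
  congr 1
  exact funext fun w => hf w v

lemma LatticePeriodic.wirtingerD {f : (Fin n → ℂ) → ℂ} (hf : LatticePeriodic f) (j : Fin n) :
    LatticePeriodic (wirtingerD n j f) := fun z v => by
  unfold _root_.wirtingerD
  rw [hf.fderiv z v]

lemma LatticePeriodic.wirtingerDbar {f : (Fin n → ℂ) → ℂ} (hf : LatticePeriodic f) (j : Fin n) :
    LatticePeriodic (wirtingerDbar n j f) := fun z v => by
  unfold _root_.wirtingerDbar
  rw [hf.fderiv z v]

lemma LatticePeriodic.tildeG {φ : (Fin n → ℂ) → ℝ} (hφ : LatticePeriodic φ) :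
    LatticePeriodic (tildeG n φ) := fun z v => by
  have h : LatticePeriodic fun u => (φ u : ℂ) := fun z v => congrArg _ (hφ z v)
  ext j k
  unfold _root_.tildeG
  rw [(h.wirtingerDbar k).wirtingerD j z v]

end LatticePeriodic

section Estimate

variable {n : ℕ} {φ : (Fin n → ℂ) → ℝ}

/-- The squared norm of `∂φ` measured with the metric `tildeG n φ`. -/
noncomputable def gradNormSq (n : ℕ) (φ : (Fin n → ℂ) → ℝ) (w : Fin n → ℂ) : ℝ :=
  (∑ j : Fin n, ∑ k : Fin n, (tildeG n φ w)⁻¹ j k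
    * wirtingerD n k (fun u => (φ u : ℂ)) w
    * (starRingEnd ℂ) (wirtingerD n j (fun u => (φ u : ℂ)) w)).re

lemma LatticePeriodic.gradNormSq (hper : LatticePeriodic φ) :
    LatticePeriodic (gradNormSq n φ) := fun z v => by
  have h : LatticePeriodic fun u => (φ u : ℂ) := fun z v => congrArg _ (hper z v)
  unfold _root_.gradNormSq
  simp_rw [hper.tildeG z v, (h.wirtingerD _) z v]

lemma continuous_gradNormSq (hφ : ContDiff ℝ (⊤ : ℕ∞) φ) (hpos : ∀ z, (tildeG n φ z).PosDef) :
    Continuous (gradNormSq n φ) := by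
  have hG : Continuous (tildeG n φ) :=
    continuous_matrix fun j k => (contDiff_tildeG_apply hφ j k).continuous
  have hinv : Continuous fun w => (tildeG n φ w)⁻¹ := by
    simp_rw [Matrix.inv_def, Ring.inverse_eq_inv']
    exact (hG.matrix_det.inv₀ fun z => (hpos z).det_pos.ne').smul hG.matrix_adjugate
  have hD : ∀ k, Continuous (wirtingerD n k fun u => (φ u : ℂ)) := fun k => by
    rw [show (wirtingerD n k fun u => (φ u : ℂ)) = _ from
      funext (wirtingerD_ofReal_comp hφ.differentiable_infty k)]
    have := (hφ.dirDeriv (Pi.single k 1)).continuous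
    have := (hφ.dirDeriv (Pi.single k Complex.I)).continuous
    fun_prop
  unfold gradNormSq
  refine Complex.continuous_re.comp (continuous_finsetSum _ fun j _ =>
    continuous_finsetSum _ fun k _ => ((hinv.matrix_elem j k).mul (hD k)).mul
      (Complex.continuous_conj.comp (hD j)))

lemma gradNormSq_nonneg (hpos : ∀ z, (tildeG n φ z).PosDef) (w : Fin n → ℂ) :
    0 ≤ gradNormSq n φ w := by
  rw [gradNormSq,
    Matrix.sum_mul_mul_conj_eq_dotProduct _ fun k => wirtingerD n k (fun u => (φ u : ℂ)) w]
  exact (hpos w).inv.posSemidef.re_dotProduct_nonneg _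

lemma re_trace_tildeG_nonneg (hpos : ∀ z, (tildeG n φ z).PosDef) (z : Fin n → ℂ) :
    0 ≤ (tildeG n φ z).trace.re :=
  (Complex.nonneg_iff.1 (hpos z).posSemidef.trace_nonneg).1

/-- The oscillation of a periodic potential is controlled by the trace of the metric and the
gradient measured in that metric. -/
lemma sub_le_of_gradNormSq_le (hφ : ContDiff ℝ (⊤ : ℕ∞) φ) (hper : LatticePeriodic φ)
    (hpos : ∀ z, (tildeG n φ z).PosDef) {M K : ℝ} (hM : ∀ z, (tildeG n φ z).trace.re ≤ M)
    (hK : ∀ z, gradNormSq n φ z ≤ K) (z p : Fin n → ℂ) :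
    φ z - φ p ≤ 4 * n * √(M * K) := by
  have hD : ∀ w k, ‖wirtingerD n k (fun u => (φ u : ℂ)) w‖ ≤ √(M * K) := by
    intro w k
    have h := (hpos w).sum_normSq_le fun k => wirtingerD n k (fun u => (φ u : ℂ)) w
    have hk := (Finset.single_le_sum (fun i _ => Complex.normSq_nonneg _)
      (Finset.mem_univ k)).trans h
    have htr := re_trace_tildeG_nonneg hpos w
    refine Real.le_sqrt_of_sq_le ?_
    rw [← Complex.normSq_eq_norm_sq]
    exact hk.trans ((mul_le_mul_of_nonneg_left (hK w) htr).trans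
      (mul_le_mul_of_nonneg_right (hM w) ((gradNormSq_nonneg hpos w).trans (hK w))))
  have hφ' : ∀ w, ‖fderiv ℝ φ w‖ ≤ 2 * n * √(M * K) := by
    intro w
    refine ContinuousLinearMap.opNorm_le_bound _ (by positivity) fun v => ?_
    refine (abs_fderiv_apply_le hφ.differentiable_infty w v).trans
      (mul_le_mul_of_nonneg_right ?_ (norm_nonneg v))
    rw [mul_assoc]
    refine mul_le_mul_of_nonneg_left ?_ zero_le_two
    simpa using Finset.sum_le_card_nsmul Finset.univ _ _ fun k _ => hD w k
  obtain ⟨w, hw, hwz⟩ := hper.exists_norm_sub_le z p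
  have h := Convex.norm_image_sub_le_of_norm_fderiv_le (𝕜 := ℝ)
    (fun x _ => hφ.differentiable_infty x) (fun x _ => hφ' x) convex_univ
    (Set.mem_univ p) (Set.mem_univ w)
  rw [hwz] at h
  calc φ z - φ p ≤ ‖φ z - φ p‖ := le_abs_self _
    _ ≤ 2 * n * √(M * K) * ‖w - p‖ := h
    _ ≤ 2 * n * √(M * K) * 2 := mul_le_mul_of_nonneg_left hw (by positivity)
    _ = _ := by ring

/-- At a maximum of `tr g̃ - φ`, the inverse of `g̃` has bounded trace. -/
lemma re_trace_inv_tildeG_le (hφ : ContDiff ℝ (⊤ : ℕ∞) φ) (hpos : ∀ z, (tildeG n φ z).PosDef)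
    {B : ℝ} {p : Fin n → ℂ}
    (hB : ‖iteratedFDeriv ℝ 2 (fun w => Real.log (tildeG n φ w).det.re) p‖ ≤ B)
    (hp : ∀ z, (tildeG n φ z).trace.re - φ z ≤ (tildeG n φ p).trace.re - φ p) :
    (tildeG n φ p)⁻¹.trace.re ≤ n + n / 2 * B := by
  obtain ⟨S, hS⟩ := (hpos p).inv.exists_eq_mul_conjTranspose
  set u := withRotation fun l j => (starRingEnd ℂ) (S j l)
  set e := withRotation fun k : Fin n => (Pi.single k (1 : ℂ) : Fin n → ℂ) with he
  set F := fun w => Real.log (tildeG n φ w).det.re with hF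
  have hFs : ContDiff ℝ (⊤ : ℕ∞) F :=
    (contDiff_re_det_tildeG hφ).log fun z => (hpos z).re_det_pos.ne'
  have hL : ∀ w, ((tildeG n φ p)⁻¹ * tildeG n φ w).trace.re =
      (tildeG n φ p)⁻¹.trace.re + 1 / 4 * sumSqDeriv u φ w := fun w => by
    rw [hS, re_trace_mul_conjTranspose_mul_tildeG hφ]
  have hLp : (n : ℝ) = (tildeG n φ p)⁻¹.trace.re + 1 / 4 * sumSqDeriv u φ p := by
    rw [← hL, Matrix.nonsing_inv_mul _ (isUnit_iff_ne_zero.2 (hpos p).det_pos.ne')]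
    simp
  have hmax : sumSqDeriv u (fun z => n + (1 / 4 * sumSqDeriv e φ z + (-1) * φ z)) p ≤ 0 := by
    refine sumSqDeriv_nonpos (contDiff_const.add ((contDiff_const.mul
      (hφ.sumSqDeriv e)).add (contDiff_const.mul hφ))) (fun z => ?_) u
    have h := hp z
    rw [re_trace_tildeG hφ, re_trace_tildeG hφ] at h
    linarith
  have hmin : sumSqDeriv e (fun z => 0 + (-(1 / 4) * sumSqDeriv u φ z + 1 * F z)) p ≤ 0 := by
    refine sumSqDeriv_nonpos (contDiff_const.add ((contDiff_const.mul
      (hφ.sumSqDeriv u)).add (contDiff_const.mul hFs))) (fun z => ?_) e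
    have h := (hpos p).log_re_det_le_add (hpos z)
    rw [hL z, Fintype.card_fin] at h
    simp only [hF]
    linarith
  rw [sumSqDeriv_const_add_mul_add_mul (hφ.sumSqDeriv e) hφ, sumSqDeriv_comm hφ] at hmax
  rw [sumSqDeriv_const_add_mul_add_mul (hφ.sumSqDeriv u) hFs] at hmin
  have hFe : -(2 * n * B) ≤ sumSqDeriv e F p := by
    have he1 : ∀ i, ‖e i‖ ≤ 1 := by
      rintro (k | k) <;> simp [he, withRotation, norm_smul, Pi.norm_single]
    have h := neg_card_mul_le_sumSqDeriv hFs he1 hB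
    rw [Fintype.card_sum, Fintype.card_fin] at h
    push_cast at h
    linarith
  linarith

end Estimate

/-- Cheng–Yau type estimate on the flat torus `ℂ^n/(ℤ+ℤi)^n`:
`tr g̃ ≤ C (1 + sup |∂φ|²_{g̃})` with `C` depending only on `n` and the bound `B`
on `F = log det g̃` up to two derivatives. -/
theorem cheng_yau_estimate_kahler_torus
    (n : ℕ) (hn : 1 ≤ n) (B : ℝ) (hB : 1 ≤ B) :
    ∃ C > 0, ∀ φ : (Fin n → ℂ) → ℝ, ContDiff ℝ (⊤ : ℕ∞) φ →
      (∀ (z : Fin n → ℂ) (v : Fin n → ℤ × ℤ),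
        φ (z + fun j => ((v j).1 : ℂ) + ((v j).2 : ℂ) * Complex.I) = φ z) →
      (∀ z, (tildeG n φ z).PosDef) →
      (∀ z, |Real.log ((tildeG n φ z).det).re|
          + ‖fderiv ℝ (fun w => Real.log ((tildeG n φ w).det).re) z‖
          + ‖iteratedFDeriv ℝ 2 (fun w => Real.log ((tildeG n φ w).det).re) z‖ ≤ B) →
      ∀ z : Fin n → ℂ, ((tildeG n φ z).trace).re
        ≤ C * (1 + ⨆ w : Fin n → ℂ,
            (∑ j : Fin n, ∑ k : Fin n, (tildeG n φ w)⁻¹ j k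
              * wirtingerD n k (fun u => (φ u : ℂ)) w
              * (starRingEnd ℂ) (wirtingerD n j (fun u => (φ u : ℂ)) w)).re) := by
  set C₀ : ℝ := n * (Real.exp B * (n + n / 2 * B) ^ (n - 1)) with hC₀
  have hC₀0 : 0 ≤ C₀ := by positivity
  refine ⟨2 * C₀ + 16 * n ^ 2 + 1, by positivity, fun φ hφ hper hpos hF z => ?_⟩
  replace hper : LatticePeriodic φ := hper
  have htr : Continuous fun z => (tildeG n φ z).trace.re := by
    simp_rw [re_trace_tildeG hφ]
    exact continuous_const.add (continuous_const.mul (hφ.sumSqDeriv _).continuous)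
  have htrper : LatticePeriodic fun z => (tildeG n φ z).trace.re := fun z v => by
    simp only [hper.tildeG z v]
  obtain ⟨q, hq⟩ := htrper.exists_forall_le htr
  obtain ⟨p, hp⟩ := LatticePeriodic.exists_forall_le
    (f := fun z => (tildeG n φ z).trace.re - φ z)
    (fun z v => by simp only [hper.tildeG z v, hper z v]) (htr.sub hφ.continuous)
  obtain ⟨r, hr⟩ := hper.gradNormSq.exists_forall_le (continuous_gradNormSq hφ hpos)
  change (tildeG n φ z).trace.re ≤ _ * (1 + ⨆ w, gradNormSq n φ w)
  set K := ⨆ w, gradNormSq n φ w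
  have hK : ∀ w, gradNormSq n φ w ≤ K :=
    le_ciSup ⟨gradNormSq n φ r, Set.forall_mem_range.2 hr⟩
  have hK0 : 0 ≤ K := (gradNormSq_nonneg hpos z).trans (hK z)
  set M := (tildeG n φ q).trace.re
  have hM0 : 0 ≤ M := re_trace_tildeG_nonneg hpos q
  have hosc : φ q - φ p ≤ 4 * n * √(M * K) := sub_le_of_gradNormSq_le hφ hper hpos hq hK q p
  have hFp := hF p
  have hdet : (tildeG n φ p).det.re ≤ Real.exp B := by
    rw [← Real.log_le_iff_le_exp (hpos p).re_det_pos]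
    exact (le_abs_self _).trans (by linarith [norm_nonneg (fderiv ℝ (fun w =>
      Real.log ((tildeG n φ w).det).re) p), norm_nonneg (iteratedFDeriv ℝ 2 (fun w =>
      Real.log ((tildeG n φ w).det).re) p)])
  have hinv := re_trace_inv_tildeG_le hφ hpos (p := p) (B := B)
    (by linarith [norm_nonneg (fderiv ℝ (fun w => Real.log ((tildeG n φ w).det).re) p),
      abs_nonneg (Real.log ((tildeG n φ p).det).re)]) hp
  have hTp : (tildeG n φ p).trace.re ≤ C₀ := by
    have h := (hpos p).re_trace_le_of_re_trace_inv_le hinv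
    rw [Fintype.card_fin] at h
    exact h.trans (by rw [hC₀]; gcongr)
  have hTq : M ≤ C₀ + 4 * n * √(M * K) := by linarith [hp q]
  rw [Real.sqrt_mul hM0] at hTq
  have hM : M ≤ 2 * C₀ + 16 * n ^ 2 * K := by
    nlinarith [sq_nonneg (√M - 4 * n * √K), Real.sq_sqrt hM0, Real.sq_sqrt hK0]
  refine (hq z).trans (hM.trans ?_)
  nlinarith [mul_nonneg hC₀0 hK0, sq_nonneg (n : ℝ)]
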